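/- arXiv:2401.06062 — 13 statements merged into one kernel-verified Lean document; each statement's English description precedes it below -/
import Mathlib

section
/- Let G be a finite group and S ⊆ G∖{1} with S = S⁻¹, S ≠ ∅ and S ≠ G∖{1}. Then Cay(G,S) has a non-trivial homogeneous set if and only if there exists a subgroup H of G with {1} ≠ H ≠ G such that for every c ∈ S∖H the right coset Hc is contained in S. -/
/-- A set `H` of vertices of a simple graph `G` is homogeneous if every vertex outside `H`
is adjacent to either all or none of the vertices of `H`. -/
def SimpleGraph.IsHomogeneousSet {V : Type*} (G : SimpleGraph V) (H : Set V) : Prop :=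
  ∀ v ∉ H, (∀ h ∈ H, G.Adj v h) ∨ (∀ h ∈ H, ¬ G.Adj v h)

open scoped Pointwise in
/-- In a graph invariant under left translations, translates of homogeneous sets are
homogeneous. -/
theorem SimpleGraph.IsHomogeneousSet.smul {G : Type*} [Group G] {Γ : SimpleGraph G}
    (hΓ : ∀ g x y : G, Γ.Adj (g * x) (g * y) ↔ Γ.Adj x y) {X : Set G}
    (hX : Γ.IsHomogeneousSet X) (g : G) : Γ.IsHomogeneousSet (g • X) := by
  intro v hv
  rw [Set.mem_smul_set_iff_inv_smul_mem, smul_eq_mul] at hv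
  have key (h : G) : Γ.Adj v (g * h) ↔ Γ.Adj (g⁻¹ * v) h := by
    rw [← hΓ g (g⁻¹ * v) h, mul_inv_cancel_left]
  refine (hX _ hv).imp ?_ ?_ <;>
  · rintro hall _ ⟨h, hh, rfl⟩
    simpa only [smul_eq_mul, key] using hall h hh

/-- The union of two intersecting homogeneous sets is homogeneous. -/
theorem SimpleGraph.IsHomogeneousSet.union {V : Type*} {Γ : SimpleGraph V} {X Y : Set V}
    (hX : Γ.IsHomogeneousSet X) (hY : Γ.IsHomogeneousSet Y) (hXY : (X ∩ Y).Nonempty) :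
    Γ.IsHomogeneousSet (X ∪ Y) := by
  obtain ⟨z, hzX, hzY⟩ := hXY
  intro v hv
  rw [Set.mem_union, not_or] at hv
  rcases hX v hv.1 with h | h <;> rcases hY v hv.2 with h' | h'
  · exact Or.inl fun w hw => hw.elim (h w) (h' w)
  · exact absurd (h z hzX) (h' z hzY)
  · exact absurd (h' z hzY) (h z hzX)
  · exact Or.inr fun w hw => hw.elim (h w) (h' w)

/-- If two homogeneous sets `X`, `Y` cover all vertices and `X` is not everything, then
`Yᶜ` is either completely joined to `Y` or completely separated from `Y`. -/
theorem SimpleGraph.IsHomogeneousSet.join_or_separated {V : Type*} {Γ : SimpleGraph V}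
    {X Y : Set V} (hX : Γ.IsHomogeneousSet X) (hY : Γ.IsHomogeneousSet Y)
    (hXY : X ∪ Y = Set.univ) {c : V} (hc : c ∉ X) :
    (∀ x ∉ Y, ∀ y ∈ Y, Γ.Adj x y) ∨ (∀ x ∉ Y, ∀ y ∈ Y, ¬ Γ.Adj x y) := by
  have cover (v : V) : v ∈ X ∨ v ∈ Y := by
    rw [← Set.mem_union, hXY]; exact Set.mem_univ v
  have hcY : c ∈ Y := (cover c).resolve_left hc
  have mem_X (x : V) (hx : x ∉ Y) : x ∈ X := (cover x).resolve_right hx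
  refine (hX c hc).imp (fun h x hx y hy => ?_) (fun h x hx y hy => ?_)
  · exact (hY x hx).elim (fun k => k y hy) fun k => absurd (h x (mem_X x hx)).symm (k c hcY)
  · exact (hY x hx).elim (fun k => absurd (k c hcY).symm (h x (mem_X x hx))) fun k => k y hy

/-- A set invariant under right multiplication by a generating set is empty or everything. -/
theorem Subgroup.mem_iff_mem_of_closure_eq_top {G : Type*} [Group G] {T A : Set G}
    (hT : Subgroup.closure T = ⊤) (hA : ∀ a, ∀ t ∈ T, (a ∈ A ↔ a * t ∈ A)) (x y : G) :
    x ∈ A ↔ y ∈ A := by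
  have key (g : G) (hg : g ∈ Subgroup.closure T) : ∀ a, a ∈ A ↔ a * g ∈ A := by
    induction hg using Subgroup.closure_induction with
    | mem t ht => exact fun a => hA a t ht
    | one => simp
    | mul g k _ _ hg hk => intro a; rw [hg a, hk, mul_assoc]
    | inv g _ hg => intro a; rw [hg (a * g⁻¹), inv_mul_cancel_right]
  simpa using key (x⁻¹ * y) (hT ▸ Subgroup.mem_top _) x

open scoped Pointwise in
/-- Let `G` be a finite group and `S ⊆ G∖{1}` with `S = S⁻¹`, `S ≠ ∅` and `S ≠ G∖{1}`.
Then `Cay(G,S)` has a non-trivial homogeneous set if and only if there is a subgroup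
`{1} ≠ H ≠ G` such that for each `c ∈ S∖H` the right coset `Hc` is contained in `S`. -/
theorem cayley_has_nontrivial_homogeneous_iff {G : Type*} [Group G] [Fintype G]
    (S : Set G) (hone : (1 : G) ∉ S) (hsymm : ∀ s : G, s ∈ S ↔ s⁻¹ ∈ S)
    (hSne : S.Nonempty) (hSneq : S ≠ {g : G | g ≠ 1})
    (Γ : SimpleGraph G) (hΓ : ∀ x y : G, Γ.Adj x y ↔ x⁻¹ * y ∈ S) :
    (∃ X : Set G, Γ.IsHomogeneousSet X ∧ 2 ≤ X.ncard ∧ X.ncard < Fintype.card G) ↔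
      ∃ H : Subgroup G, H ≠ ⊥ ∧ H ≠ ⊤ ∧
        ∀ c ∈ S, c ∉ H → ∀ h ∈ H, h * c ∈ S := by
  constructor
  · rintro ⟨X, hX, hX2, hXlt⟩
    by_cases hS : Subgroup.closure S = ⊤
    swap
    · obtain ⟨s, hs⟩ := hSne
      refine ⟨Subgroup.closure S, fun hbot => ?_, hS,
        fun c hc hcS => absurd (Subgroup.subset_closure hc) hcS⟩
      have hs1 : s = 1 := Subgroup.mem_bot.1 (hbot ▸ Subgroup.subset_closure hs)
      exact hone (hs1 ▸ hs)
    by_cases hT : Subgroup.closure {g : G | g ≠ 1 ∧ g ∉ S} = ⊤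
    swap
    · refine ⟨_, fun hbot => hSneq ?_, hT, fun c _ hcT h hh => ?_⟩
      · ext g
        refine ⟨fun hg hg1 => hone (hg1 ▸ hg), fun hg => ?_⟩
        by_contra hgS
        exact hg (Subgroup.mem_bot.1 (hbot ▸ Subgroup.subset_closure ⟨hg, hgS⟩))
      · by_contra hhc
        have hmem : h * c ∉ Subgroup.closure {g : G | g ≠ 1 ∧ g ∉ S} := fun hm =>
          hcT ((Subgroup.mul_mem_cancel_left _ hh).1 hm)
        exact hmem (Subgroup.subset_closure
          ⟨fun h1 => hmem (by rw [h1]; exact Subgroup.one_mem _), hhc⟩)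
    have hinv (g x y : G) : Γ.Adj (g * x) (g * y) ↔ Γ.Adj x y := by
      rw [hΓ, hΓ, mul_inv_rev, mul_assoc, inv_mul_cancel_left]
    obtain ⟨a, b, ha, hb, hab⟩ := (Set.one_lt_ncard_iff (Set.toFinite X)).1 hX2
    have hXuniv : X ≠ Set.univ := by
      rintro rfl
      simp [Set.ncard_univ, Nat.card_eq_fintype_card] at hXlt
    obtain ⟨M, hXM, ⟨hM, hMuniv⟩, hmax⟩ :=
      (Set.toFinite {Y : Set G | Γ.IsHomogeneousSet Y ∧ Y ≠ Set.univ}).exists_le_maximal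
        (a := a⁻¹ • X) ⟨hX.smul hinv a⁻¹, by simpa using hXuniv⟩
    have hM1 : (1 : G) ∈ M := hXM ⟨a, ha, by simp⟩
    have hMb : a⁻¹ * b ∈ M := hXM ⟨b, hb, rfl⟩
    have eq_of_meet (g : G) (hg : (g • M ∩ M).Nonempty) : g • M = M := by
      have hcover : g • M ∪ M ≠ Set.univ := by
        intro huniv
        have hgM : ∃ c, c ∉ g • M := by
          rwa [← Set.ne_univ_iff_exists_notMem, Ne, Set.smul_set_eq_univ]
        obtain ⟨c, hc⟩ := hgM
        obtain ⟨v, hv⟩ := (Set.ne_univ_iff_exists_notMem M).1 hMuniv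
        rcases (hM.smul hinv g).join_or_separated hM huniv hc with h | h
        · refine hv ((Subgroup.mem_iff_mem_of_closure_eq_top hT ?_ 1 v).1 hM1)
          intro x t ht
          by_contra hne
          rw [not_iff] at hne
          by_cases hx : x ∈ M
          · have := (h (x * t) (fun h' => hne.2 h' hx) x hx).symm
            rw [hΓ, inv_mul_cancel_left] at this
            exact ht.2 this
          · have := h x hx (x * t) (hne.1 hx)
            rw [hΓ, inv_mul_cancel_left] at this
            exact ht.2 this
        · refine hv ((Subgroup.mem_iff_mem_of_closure_eq_top hS ?_ 1 v).1 hM1)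
          intro x t ht
          have hadj : Γ.Adj x (x * t) := by rwa [hΓ, inv_mul_cancel_left]
          by_contra hne
          rw [not_iff] at hne
          by_cases hx : x ∈ M
          · exact h (x * t) (fun h' => hne.2 h' hx) x hx hadj.symm
          · exact h x hx (x * t) (hne.1 hx) hadj
      have hle : g • M ⊆ M := Set.subset_union_left.trans
        (hmax ⟨(hM.smul hinv g).union hM hg, hcover⟩ Set.subset_union_right)
      exact Set.eq_of_subset_of_ncard_le hle (Set.ncard_smul_set g M).ge
    have mem_stab (g : G) : g ∈ MulAction.stabilizer G M ↔ g ∈ M := by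
      rw [MulAction.mem_stabilizer_iff]
      refine ⟨fun hg => hg ▸ ⟨1, hM1, by simp⟩, fun hg => eq_of_meet g ⟨g, ⟨1, hM1, by simp⟩, hg⟩⟩
    refine ⟨MulAction.stabilizer G M, fun hbot => hab ?_, fun htop => hMuniv ?_,
      fun c hc hcH h hh => ?_⟩
    · have := (mem_stab _).2 hMb
      rwa [hbot, Subgroup.mem_bot, inv_mul_eq_one] at this
    · exact Set.eq_univ_of_forall fun g => (mem_stab g).1 (htop ▸ Subgroup.mem_top g)
    · rw [mem_stab] at hcH
      have hc1 : Γ.Adj c 1 := by rwa [hΓ, mul_one, ← hsymm]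
      have hall := (hM c hcH).resolve_right fun hnone => hnone 1 hM1 hc1
      have := hall h⁻¹ ((mem_stab _).1 (inv_mem hh))
      rwa [hΓ, ← mul_inv_rev, ← hsymm] at this
  · rintro ⟨H, hbot, htop, hH⟩
    refine ⟨H, fun v hv => ?_, ?_, ?_⟩
    · by_contra! hcon
      obtain ⟨⟨k, hk, hvk⟩, h, hh, hvh⟩ := hcon
      rw [hΓ, hsymm, mul_inv_rev, inv_inv] at hvk hvh
      refine hvk ?_
      have := hH _ hvh (fun hm => hv ((Subgroup.mul_mem_cancel_left _ (inv_mem hh)).1 hm))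
        (k⁻¹ * h) (mul_mem (inv_mem hk) hh)
      rwa [mul_assoc, mul_inv_cancel_left] at this
    · exact (Subgroup.one_lt_card_iff_ne_bot H).2 hbot
    · rw [← Nat.card_eq_fintype_card, ← Set.ncard_univ]
      exact Set.ncard_lt_ncard
        (Set.ssubset_univ_iff.2 fun h => htop (SetLike.coe_injective (by simpa using h)))
end

section
/- Let G be a finite group, S ⊆ G∖{1} with S = S⁻¹, and let H ⊆ G be a homogeneous set of Cay(G,S) containing the identity element 1. Then the subgroup ⟨H⟩ generated by H is also a homogeneous set of Cay(G,S). -/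
/-- If `H` is a homogeneous set of the Cayley graph `Cay(G,S)` containing `1`, then the
subgroup generated by `H` is also a homogeneous set of `Cay(G,S)`. -/
theorem closure_of_homogeneous_set_is_homogeneous {G : Type*} [Group G] [Fintype G]
    (S : Set G) (hone : (1 : G) ∉ S) (hsymm : ∀ s : G, s ∈ S ↔ s⁻¹ ∈ S)
    (Γ : SimpleGraph G) (hΓ : ∀ x y : G, Γ.Adj x y ↔ x⁻¹ * y ∈ S)
    (H : Set G) (hH1 : (1 : G) ∈ H) (hH : Γ.IsHomogeneousSet H) :
    Γ.IsHomogeneousSet (Subgroup.closure H : Set G) := by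
  have key : ∀ k ∈ Subgroup.closure H, ∀ w ∉ Subgroup.closure H, w * k ∈ S ↔ w ∈ S := by
    intro k hk
    induction hk using Subgroup.closure_induction with
    | mem h hh =>
      intro w hw
      have hw' : w⁻¹ ∉ H := fun hmem =>
        hw (inv_mem_iff.mp (Subgroup.subset_closure hmem))
      rcases hH w⁻¹ hw' with hall | hnone
      · have h₁ := hall h hh
        have h₂ := hall 1 hH1
        simp only [hΓ, inv_inv, mul_one] at h₁ h₂
        exact iff_of_true h₁ h₂
      · have h₁ := hnone h hh
        have h₂ := hnone 1 hH1
        simp only [hΓ, inv_inv, mul_one] at h₁ h₂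
        exact iff_of_false h₁ h₂
    | one => simp
    | mul x y hx hy ihx ihy =>
      intro w hw
      rw [← mul_assoc, ihy _ (by rwa [Subgroup.mul_mem_cancel_right _ hx]), ihx w hw]
    | inv x hx ih =>
      intro w hw
      rw [← ih (w * x⁻¹) (by rwa [Subgroup.mul_mem_cancel_right _ (inv_mem hx)]),
        inv_mul_cancel_right]
  intro v hv
  have hv' : v⁻¹ ∉ Subgroup.closure H := fun hmem => hv (inv_mem_iff.mp hmem)
  by_cases hS : v⁻¹ ∈ S
  · exact Or.inl fun k hk => (hΓ v k).mpr ((key k hk _ hv').mpr hS)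
  · exact Or.inr fun k hk hadj => hS ((key k hk _ hv').mp ((hΓ v k).mp hadj))
end

section
/- Let Γ be a finite simple directed graph (an irreflexive adjacency relation on a finite vertex set) that is vertex-transitive and has at least one edge and at least one non-edge between distinct vertices. Then Γ is a non-trivial wreath product of digraphs if and only if Γ has a non-trivial bihomogeneous set. -/
/-- A set `H` of vertices of a digraph (given by its adjacency relation `A`) is
in-homogeneous if every vertex `v` outside `H` satisfies: either `v h` is an edge for all
`h ∈ H`, or for none of them. -/
def IsInHomogeneous {V : Type*} (A : V → V → Prop) (H : Set V) : Prop :=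
  ∀ v ∉ H, (∀ h ∈ H, A v h) ∨ (∀ h ∈ H, ¬ A v h)

/-- Out-homogeneous: edges from `H` to the outside vertex. -/
def IsOutHomogeneous {V : Type*} (A : V → V → Prop) (H : Set V) : Prop :=
  ∀ v ∉ H, (∀ h ∈ H, A h v) ∨ (∀ h ∈ H, ¬ A h v)

/-- Bihomogeneous: both in- and out-homogeneous. -/
def IsBihomogeneous {V : Type*} (A : V → V → Prop) (H : Set V) : Prop :=
  IsInHomogeneous A H ∧ IsOutHomogeneous A H

/-- The wreath product of two digraphs (as adjacency relations). -/
def DiWreath {α β : Type*} (A : α → α → Prop) (B : β → β → Prop) :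
    α × β → α × β → Prop :=
  fun x y => A x.1 y.1 ∨ (x.1 = y.1 ∧ B x.2 y.2)

/-- The digraph is isomorphic to a wreath product of two digraphs with at least two vertices. -/
def IsNontrivialDiWreath {V : Type*} (A : V → V → Prop) : Prop :=
  ∃ (m n : ℕ), 2 ≤ m ∧ 2 ≤ n ∧
    ∃ (B : Fin m → Fin m → Prop) (C : Fin n → Fin n → Prop),
      Irreflexive B ∧ Irreflexive C ∧
        ∃ e : V ≃ Fin m × Fin n, ∀ x y : V, A x y ↔ DiWreath B C (e x) (e y)

/-- `e` preserves adjacency. -/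
def IsDiAut {V : Type*} (A : V → V → Prop) (e : V ≃ V) : Prop :=
  ∀ x y : V, A x y ↔ A (e x) (e y)

theorem IsDiAut.symm {V : Type*} {A : V → V → Prop} {e : V ≃ V} (he : IsDiAut A e) :
    IsDiAut A e.symm := fun x y => by
  rw [he (e.symm x) (e.symm y), e.apply_symm_apply, e.apply_symm_apply]

theorem isBihomogeneous_iff {V : Type*} {A : V → V → Prop} {H : Set V} :
    IsBihomogeneous A H ↔
      ∀ v ∉ H, ∀ x ∈ H, ∀ y ∈ H, (A v x ↔ A v y) ∧ (A x v ↔ A y v) := by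
  constructor
  · rintro ⟨hin, hout⟩ v hv x hx y hy
    have h₁ := hin v hv
    have h₂ := hout v hv
    grind
  · intro h
    refine ⟨fun v hv => ?_, fun v hv => ?_⟩
    · by_cases hx : ∃ x ∈ H, A v x
      · obtain ⟨x, hx, hvx⟩ := hx
        exact .inl fun y hy => (h v hv x hx y hy).1.1 hvx
      · exact .inr fun y hy hvy => hx ⟨y, hy, hvy⟩
    · by_cases hx : ∃ x ∈ H, A x v
      · obtain ⟨x, hx, hvx⟩ := hx
        exact .inl fun y hy => (h v hv x hx y hy).2.1 hvx
      · exact .inr fun y hy hvy => hx ⟨y, hy, hvy⟩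

theorem IsBihomogeneous.inter {V : Type*} {A : V → V → Prop} {H K : Set V}
    (hH : IsBihomogeneous A H) (hK : IsBihomogeneous A K) : IsBihomogeneous A (H ∩ K) := by
  rw [isBihomogeneous_iff] at *
  rintro v hv x ⟨hxH, hxK⟩ y ⟨hyH, hyK⟩
  by_cases hvH : v ∈ H
  · exact hK v (fun hvK => hv ⟨hvH, hvK⟩) x hxK y hyK
  · exact hH v hvH x hxH y hyH

theorem IsBihomogeneous.diff {V : Type*} {A : V → V → Prop} {H K : Set V}
    (hH : IsBihomogeneous A H) (hK : IsBihomogeneous A K) (hKH : (K \ H).Nonempty) :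
    IsBihomogeneous A (H \ K) := by
  obtain ⟨w, hwK, hwH⟩ := hKH
  rw [isBihomogeneous_iff] at *
  rintro v hv x ⟨hxH, hxK⟩ y ⟨hyH, hyK⟩
  by_cases hvH : v ∈ H
  · have hvK : v ∈ K := by
      by_contra hvK
      exact hv ⟨hvH, hvK⟩
    have h₁ := hK x hxK v hvK w hwK
    have h₂ := hK y hyK v hvK w hwK
    have h₃ := hH w hwH x hxH y hyH
    tauto
  · exact hH v hvH x hxH y hyH

theorem IsBihomogeneous.image {V : Type*} {A : V → V → Prop} {H : Set V} {e : V ≃ V}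
    (hH : IsBihomogeneous A H) (he : IsDiAut A e) : IsBihomogeneous A (e '' H) := by
  rw [isBihomogeneous_iff] at *
  rintro v hv _ ⟨x, hx, rfl⟩ _ ⟨y, hy, rfl⟩
  obtain ⟨u, rfl⟩ := e.surjective v
  rw [← he, ← he, ← he, ← he]
  exact hH u (fun hu => hv ⟨u, hu, rfl⟩) x hx y hy

/-- An automorphism-invariant equivalence relation with bihomogeneous classes decomposes a
vertex-transitive digraph as a wreath product. -/
theorem exists_diWreath_of_setoid {V : Type*} [Fintype V]
    {A : V → V → Prop} (hirr : Irreflexive A)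
    (hvt : ∀ u v : V, ∃ e : V ≃ V, e u = v ∧ IsDiAut A e) (s : Setoid V)
    (hinv : ∀ e : V ≃ V, IsDiAut A e → ∀ x y, s x y → s (e x) (e y))
    (hmod : ∀ v x y, s x y → ¬ s v x → (A v x ↔ A v y) ∧ (A x v ↔ A y v))
    (hrel : ∃ x y, x ≠ y ∧ s x y) (hnrel : ∃ x y, ¬ s x y) :
    IsNontrivialDiWreath A := by
  classical
  obtain ⟨a, b, hab, hsab⟩ := hrel
  obtain ⟨c, d, hcd⟩ := hnrel
  choose g hga hg using fun q : Quotient s => hvt a q.out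
  have hout (x : V) : s (Quotient.mk s x).out x := Quotient.mk_out x
  let D := {x : V // s x a}
  let f : V ≃ Quotient s × D :=
    { toFun := fun x => (Quotient.mk s x, ⟨(g (Quotient.mk s x)).symm x, by
        have h := hinv _ (hg (Quotient.mk s x)).symm _ _ (s.symm (hout x))
        rwa [← hga, Equiv.symm_apply_apply] at h⟩)
      invFun := fun p => g p.1 p.2.1
      left_inv := fun x => by simp
      right_inv := fun ⟨q, x, hx⟩ => by
        have h : Quotient.mk s (g q x) = q := by
          have h₁ := hinv _ (hg q) _ _ hx
          rw [hga] at h₁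
          exact (Quotient.sound h₁).trans q.out_eq
        ext
        · exact h
        · simp [h] }
  let k := Fintype.equivFin (Quotient s)
  let l := Fintype.equivFin D
  refine ⟨_, _, ?_, ?_, fun i j => i ≠ j ∧ A (k.symm i).out (k.symm j).out,
    fun i j => A (l.symm i).1 (l.symm j).1, fun i h => h.1 rfl, fun i h => hirr _ h,
    f.trans (k.prodCongr l), fun x y => ?_⟩
  · exact Fintype.one_lt_card_iff.2 ⟨Quotient.mk s c, Quotient.mk s d,
      fun h => hcd (Quotient.exact h)⟩
  · exact Fintype.one_lt_card_iff.2 ⟨⟨a, s.refl a⟩, ⟨b, s.symm hsab⟩,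
      fun h => hab (congrArg Subtype.val h)⟩
  · have key : A x y ↔ (Quotient.mk s x ≠ Quotient.mk s y ∧
        A (Quotient.mk s x).out (Quotient.mk s y).out) ∨ (Quotient.mk s x = Quotient.mk s y ∧
        A ((g (Quotient.mk s x)).symm x) ((g (Quotient.mk s y)).symm y)) := by
      by_cases h : Quotient.mk s x = Quotient.mk s y
      · simp only [h, ne_eq, not_true_eq_false, false_and, true_and, false_or]
        exact (hg _).symm x y
      · have hxy : ¬ s x y := fun hs => h (Quotient.sound hs)
        have h₁ := (hmod x y _ (s.symm (hout y)) hxy).1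
        have h₂ := (hmod (Quotient.mk s y).out x _ (s.symm (hout x))
          fun hs => hxy (s.symm (s.trans (s.symm (hout y)) hs))).2
        simp only [h, ne_eq, not_false_eq_true, true_and, false_and, or_false]
        exact h₁.trans h₂
    simpa [DiWreath, f, Equiv.prodCongr] using key

/-- Vertices with the same in- and out-neighbours. -/
def twinSetoid {V : Type*} (A : V → V → Prop) : Setoid V where
  r x y := ∀ v, (A v x ↔ A v y) ∧ (A x v ↔ A y v)
  iseqv :=
    { refl := fun _ _ => ⟨Iff.rfl, Iff.rfl⟩
      symm := fun h v => ⟨(h v).1.symm, (h v).2.symm⟩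
      trans := fun h h' v => ⟨(h v).1.trans (h' v).1, (h v).2.trans (h' v).2⟩ }

theorem twinSetoid_map {V : Type*} {A : V → V → Prop} {e : V ≃ V} (he : IsDiAut A e)
    {x y : V} (h : twinSetoid A x y) : twinSetoid A (e x) (e y) := by
  intro v
  obtain ⟨u, rfl⟩ := e.surjective v
  rw [← he, ← he, ← he, ← he]
  exact h u

theorem not_adj_of_twinSetoid {V : Type*} {A : V → V → Prop} (hirr : Irreflexive A)
    {x y : V} (h : twinSetoid A x y) : ¬ A x y := fun hxy => hirr y ((h y).2.1 hxy)

/-- Out-degrees agree, so a bihomogeneous pair in a vertex-transitive digraph is symmetric. -/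
theorem adj_symm_of_isBihomogeneous_pair {V : Type*} [Fintype V]
    {A : V → V → Prop} (hirr : Irreflexive A)
    (hvt : ∀ u v : V, ∃ e : V ≃ V, e u = v ∧ IsDiAut A e) {a b : V}
    (hH : IsBihomogeneous A {a, b}) (hab : A a b) : A b a := by
  by_contra hba
  rw [isBihomogeneous_iff] at hH
  have hlt : {v | A b v}.ncard < {v | A a v}.ncard := by
    refine Set.ncard_lt_ncard ⟨fun v hv => ?_, fun h => hirr b (h hab)⟩ (Set.toFinite _)
    by_cases hva : v = a
    · exact absurd (hva ▸ hv) hba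
    by_cases hvb : v = b
    · exact hvb ▸ hab
    exact (hH v (by simp [hva, hvb]) a (by simp) b (by simp)).2.2 hv
  obtain ⟨e, rfl, he⟩ := hvt a b
  have himg : {v | A (e a) v} = e '' {v | A a v} := by
    ext v
    obtain ⟨u, rfl⟩ := e.surjective v
    simp [← he a u]
  rw [himg, Set.ncard_image_of_injective _ e.injective] at hlt
  exact hlt.false

/-- A vertex-transitive digraph with a bihomogeneous pair is a wreath product. -/
theorem exists_diWreath_of_isBihomogeneous_pair {V : Type*} [Fintype V]
    {A : V → V → Prop} (hirr : Irreflexive A)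
    (hvt : ∀ u v : V, ∃ e : V ≃ V, e u = v ∧ IsDiAut A e)
    (hEdge : ∃ x y : V, A x y) (hNonEdge : ∃ x y : V, x ≠ y ∧ ¬ A x y)
    {a b : V} (hab : a ≠ b) (hH : IsBihomogeneous A {a, b}) :
    IsNontrivialDiWreath A := by
  have hsymm : A a b ↔ A b a := ⟨adj_symm_of_isBihomogeneous_pair hirr hvt hH,
    adj_symm_of_isBihomogeneous_pair hirr hvt (Set.pair_comm a b ▸ hH)⟩
  have hpair := isBihomogeneous_iff.1 hH
  have hout (v : V) (hva : v ≠ a) (hvb : v ≠ b) : (A v a ↔ A v b) ∧ (A a v ↔ A b v) :=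
    hpair v (by simp [hva, hvb]) a (by simp) b (by simp)
  by_cases hadj : A a b
  · let A' : V → V → Prop := fun x y => A x y ∨ x = y
    refine exists_diWreath_of_setoid hirr hvt (twinSetoid A')
      (fun e he x y h => twinSetoid_map (fun u v => ?_) h) (fun v x y h hv => ?_)
      ⟨a, b, hab, fun v => ?_⟩ ?_
    · simp only [A', ← he u v, e.injective.eq_iff]
    · have hvx : v ≠ x := by
        rintro rfl
        exact hv ((twinSetoid A').refl v)
      have hvy : v ≠ y := by
        rintro rfl
        exact hv ((twinSetoid A').symm h)
      simpa [A', hvx, hvy, hvx.symm, hvy.symm] using h v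
    · have hba := hsymm.1 hadj
      have := hout v
      simp only [A']
      grind
    · obtain ⟨x, y, hxy, hn⟩ := hNonEdge
      refine ⟨x, y, fun h => ?_⟩
      rcases (h y).2.2 (.inr rfl) with h | h
      · exact hn h
      · exact hxy h
  · refine exists_diWreath_of_setoid hirr hvt (twinSetoid A)
      (fun e he x y h => twinSetoid_map he h) (fun v x y h _ => h v)
      ⟨a, b, hab, fun v => ?_⟩ ?_
    · have hba := hsymm.not.1 hadj
      have haa := hirr a
      have hbb := hirr b
      have := hout v
      grind
    · obtain ⟨x, y, hxy⟩ := hEdge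
      exact ⟨x, y, fun h => not_adj_of_twinSetoid hirr h hxy⟩

/-- Bihomogeneous sets of minimal size at least three are pairwise equal or disjoint. -/
theorem IsBihomogeneous.eq_of_minimal {V : Type*} [Fintype V] {A : V → V → Prop}
    {n : ℕ} (hn : 3 ≤ n)
    (hmin : ∀ L : Set V, IsBihomogeneous A L → 2 ≤ L.ncard → n ≤ L.ncard)
    {H K : Set V} (hH : IsBihomogeneous A H) (hHn : H.ncard = n)
    (hK : IsBihomogeneous A K) (hKn : K.ncard = n) (hHK : (H ∩ K).Nonempty) : H = K := by
  have hsum := Set.ncard_inter_add_ncard_sdiff_eq_ncard H K (Set.toFinite H)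
  have hpos : 0 < (H ∩ K).ncard := (Set.ncard_pos (Set.toFinite _)).2 hHK
  by_contra hne
  have hKH : (K \ H).Nonempty := by
    rw [Set.sdiff_nonempty]
    exact fun h => hne (Set.eq_of_subset_of_ncard_le h (by omega) (Set.toFinite _)).symm
  have hHK' : (H \ K).Nonempty := by
    rw [Set.sdiff_nonempty]
    exact fun h => hne (Set.eq_of_subset_of_ncard_le h (by omega) (Set.toFinite _))
  have hpos' : 0 < (H \ K).ncard := (Set.ncard_pos (Set.toFinite _)).2 hHK'
  have h₁ := hmin _ (hH.inter hK)
  have h₂ := hmin _ (hH.diff hK hKH)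
  omega

/-- A vertex-transitive digraph with a non-trivial bihomogeneous set of minimal size at least
three is a wreath product. -/
theorem exists_diWreath_of_minimal {V : Type*} [Fintype V]
    {A : V → V → Prop} (hirr : Irreflexive A)
    (hvt : ∀ u v : V, ∃ e : V ≃ V, e u = v ∧ IsDiAut A e) {H : Set V}
    (hH : IsBihomogeneous A H) (hH3 : 3 ≤ H.ncard) (hHV : H.ncard < Fintype.card V)
    (hmin : ∀ L : Set V, IsBihomogeneous A L → 2 ≤ L.ncard → H.ncard ≤ L.ncard) :
    IsNontrivialDiWreath A := by
  let s : Setoid V :=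
    { r := fun x y => ∀ K, IsBihomogeneous A K → K.ncard = H.ncard → (x ∈ K ↔ y ∈ K)
      iseqv :=
        { refl := fun _ _ _ _ => Iff.rfl
          symm := fun h K hK hn => (h K hK hn).symm
          trans := fun h h' K hK hn => (h K hK hn).trans (h' K hK hn) } }
  have hs {K : Set V} (hK : IsBihomogeneous A K) (hKn : K.ncard = H.ncard) {x y : V}
      (hx : x ∈ K) (hy : y ∈ K) : s x y := by
    intro L hL hLn
    constructor
    · intro h
      rwa [hL.eq_of_minimal hH3 hmin hLn hK hKn ⟨x, h, hx⟩]
    · intro h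
      rwa [hL.eq_of_minimal hH3 hmin hLn hK hKn ⟨y, h, hy⟩]
  obtain ⟨a, ha, b, hb, hab⟩ := (Set.one_lt_ncard (Set.toFinite H)).1 (by omega)
  refine exists_diWreath_of_setoid hirr hvt s (fun e he x y h K hK hKn => ?_)
    (fun v x y h hv => ?_) ⟨a, b, hab, hs hH rfl ha hb⟩ ?_
  · have := h (e.symm '' K) (hK.image he.symm)
      (by rw [Set.ncard_image_of_injective _ e.symm.injective, hKn])
    simpa [Equiv.symm_apply_eq] using this
  · obtain ⟨e, rfl, he⟩ := hvt a x
    have hn : (e '' H).ncard = H.ncard := Set.ncard_image_of_injective _ e.injective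
    have hx : e a ∈ e '' H := ⟨a, ha, rfl⟩
    exact isBihomogeneous_iff.1 (hH.image he) v (fun h' => hv (hs (hH.image he) hn h' hx))
      _ hx y ((h _ (hH.image he) hn).1 hx)
  · obtain ⟨c, hc⟩ : ∃ c, c ∉ H := by
      by_contra! h
      rw [Set.eq_univ_of_forall h, Set.ncard_univ, Nat.card_eq_fintype_card] at hHV
      exact hHV.false
    exact ⟨a, c, fun h => hc ((h H hH rfl).1 ha)⟩

/-- A finite vertex-transitive simple digraph that has at least one edge and at least one
non-edge between distinct vertices is a non-trivial wreath product of digraphs if and only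
if it has a non-trivial bihomogeneous set. -/
theorem digraph_wreath_iff_bihomogeneous {V : Type*} [Fintype V]
    (A : V → V → Prop) (hirr : Irreflexive A)
    (hvt : ∀ u v : V, ∃ e : V ≃ V, e u = v ∧ ∀ x y : V, A x y ↔ A (e x) (e y))
    (hEdge : ∃ x y : V, A x y)
    (hNonEdge : ∃ x y : V, x ≠ y ∧ ¬ A x y) :
    (∃ (m n : ℕ), 2 ≤ m ∧ 2 ≤ n ∧
        ∃ (B : Fin m → Fin m → Prop) (C : Fin n → Fin n → Prop),
          Irreflexive B ∧ Irreflexive C ∧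
            ∃ e : V ≃ Fin m × Fin n, ∀ x y : V, A x y ↔ DiWreath B C (e x) (e y)) ↔
      ∃ H : Set V, IsBihomogeneous A H ∧ 2 ≤ H.ncard ∧ H.ncard < Fintype.card V := by
  constructor
  · rintro ⟨m, n, hm, hn, B, C, -, -, e, he⟩
    have hcard : Fintype.card V = m * n := by
      simpa using Fintype.card_congr e
    let i : Fin m := ⟨0, by omega⟩
    have hH : {x | (e x).1 = i}.ncard = n := by
      have himg : {x | (e x).1 = i} = Set.range fun j : Fin n => e.symm (i, j) := by
        ext x
        constructor
        · intro hx
          exact ⟨(e x).2, by rw [e.symm_apply_eq, ← show (e x).1 = i from hx]⟩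
        · rintro ⟨j, rfl⟩
          simp
      rw [himg, ← Set.image_univ, Set.ncard_image_of_injective _ fun j k h => by simpa using h]
      simp [Set.ncard_univ]
    refine ⟨{x | (e x).1 = i}, isBihomogeneous_iff.2 fun v hv x hx y hy => ?_, ?_, ?_⟩
    · simp only [Set.mem_ofPred_eq] at hv hx hy
      simp [he, DiWreath, hx, hy, hv, Ne.symm hv]
    · rwa [hH]
    · rw [hH, hcard]
      nlinarith
  · intro hex
    classical
    let P : ℕ → Prop := fun k => ∃ H : Set V, IsBihomogeneous A H ∧ 2 ≤ H.ncard ∧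
      H.ncard < Fintype.card V ∧ H.ncard = k
    have hP : ∃ k, P k := by
      obtain ⟨H, h₁, h₂, h₃⟩ := hex
      exact ⟨_, H, h₁, h₂, h₃, rfl⟩
    obtain ⟨H, hH, hH2, hHV, hHk⟩ := Nat.find_spec hP
    have hmin (L : Set V) (hL : IsBihomogeneous A L) (hL2 : 2 ≤ L.ncard) :
        H.ncard ≤ L.ncard := by
      by_cases hLV : L.ncard < Fintype.card V
      · exact hHk ▸ Nat.find_min' hP ⟨L, hL, hL2, hLV, rfl⟩
      · omega
    rcases hH2.eq_or_lt with h | h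
    · obtain ⟨a, b, hab, rfl⟩ := Set.ncard_eq_two.1 h.symm
      exact exists_diWreath_of_isBihomogeneous_pair hirr hvt hEdge hNonEdge hab hH
    · exact exists_diWreath_of_minimal hirr hvt hH h hHV hmin
end

section
/- Let R be a finite commutative ring and let S be a subgroup of the group of units R^× with −1 ∈ S. Suppose Cay(R,S) is connected and anti-connected. If Cay(R,S) is not prime, then there exists an ideal I of R with 0 ≠ I ≠ R such that I is a homogeneous set of Cay(R,S). -/
namespace SimpleGraph

variable {V W : Type*} {G : SimpleGraph V} {A B : Set V}

lemma Connected.exists_adj_of_ne_univ (hG : G.Connected) (hA : A.Nonempty)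
    (hA' : A ≠ Set.univ) : ∃ a ∈ A, ∃ b ∉ A, G.Adj b a := by
  obtain ⟨x, hx⟩ := hA
  obtain ⟨y, hy⟩ := (Set.ne_univ_iff_exists_notMem A).1 hA'
  obtain ⟨p⟩ := hG.preconnected x y
  obtain ⟨d, -, h1, h2⟩ := p.exists_boundary_dart A hx hy
  exact ⟨d.fst, h1, d.snd, h2, d.adj.symm⟩

lemma IsHomogeneousSet.preimage {G' : SimpleGraph W} {H : Set W} (hH : G'.IsHomogeneousSet H)
    (f : G ≃g G') : G.IsHomogeneousSet (f ⁻¹' H) := by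
  intro v hv
  rcases hH (f v) hv with h | h
  · exact Or.inl fun x hx => f.map_adj_iff.1 (h _ hx)
  · exact Or.inr fun x hx hadj => h _ hx (f.map_adj_iff.2 hadj)

lemma IsHomogeneousSet.union_s6 (hA : G.IsHomogeneousSet A) (hB : G.IsHomogeneousSet B)
    (hAB : (A ∩ B).Nonempty) : G.IsHomogeneousSet (A ∪ B) := by
  obtain ⟨p, hpA, hpB⟩ := hAB
  intro v hv
  rw [Set.mem_union, not_or] at hv
  rcases hA v hv.1 with h | h <;> rcases hB v hv.2 with h' | h'
  · exact Or.inl fun x hx => hx.elim (h x) (h' x)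
  · exact absurd (h p hpA) (h' p hpB)
  · exact absurd (h' p hpB) (h p hpA)
  · exact Or.inr fun x hx => hx.elim (h x) (h' x)

lemma IsHomogeneousSet.union_ne_univ (hG : G.Connected) (hG' : Gᶜ.Connected)
    (hA : G.IsHomogeneousSet A) (hB : G.IsHomogeneousSet B)
    (hAne : A ≠ Set.univ) (hBne : B ≠ Set.univ) : A ∪ B ≠ Set.univ := by
  intro hU
  have hmem (x : V) : x ∈ A ∨ x ∈ B := by
    rw [← Set.mem_union, hU]
    trivial
  obtain ⟨y, hyB⟩ := (Set.ne_univ_iff_exists_notMem B).1 hBne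
  have hyA : y ∈ A := (hmem y).resolve_right hyB
  obtain ⟨a, ha, b, hb, hab⟩ := hG.exists_adj_of_ne_univ ⟨y, hyA⟩ hAne
  obtain ⟨a', ha', b', hb', hab'⟩ := hG'.exists_adj_of_ne_univ ⟨y, hyA⟩ hAne
  have h1 : G.Adj b y := (hA b hb).elim (fun h => h y hyA) fun h => absurd hab (h a ha)
  have h2 : ¬ G.Adj b' y := (hA b' hb').elim
    (fun h => absurd (h a' ha') ((compl_adj G b' a').1 hab').2) fun h => h y hyA
  rcases hB y hyB with h | h
  · exact h2 (h b' ((hmem b').resolve_left hb')).symm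
  · exact h b ((hmem b).resolve_left hb) h1.symm

/-- In a finite connected and anti-connected graph, the proper homogeneous sets containing a
given vertex have a greatest element. -/
lemma exists_greatest_isHomogeneousSet [Finite V] (hG : G.Connected) (hG' : Gᶜ.Connected)
    {v : V} (hv : ({v} : Set V) ≠ Set.univ) :
    ∃ M, IsGreatest {H : Set V | G.IsHomogeneousSet H ∧ v ∈ H ∧ H ≠ Set.univ} M := by
  have hsingle : G.IsHomogeneousSet {v} := by
    intro w _
    by_cases h : G.Adj w v
    · exact Or.inl fun x hx => by rwa [Set.mem_singleton_iff.1 hx]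
    · exact Or.inr fun x hx => by rwa [Set.mem_singleton_iff.1 hx]
  obtain ⟨M, hM⟩ := (Set.toFinite
    {H : Set V | G.IsHomogeneousSet H ∧ v ∈ H ∧ H ≠ Set.univ}).exists_maximal
    ⟨{v}, hsingle, rfl, hv⟩
  obtain ⟨hMhom, hvM, hMne⟩ := hM.prop
  refine ⟨M, hM.prop, fun H ⟨hH, hvH, hHne⟩ => ?_⟩
  exact Set.subset_union_right.trans (hM.le_of_ge
    ⟨hMhom.union_s6 hH ⟨v, hvM, hvH⟩, Or.inl hvM, hMhom.union_ne_univ hG hG' hH hMne hHne⟩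
    Set.subset_union_left)

end SimpleGraph


/-- Let `R` be a finite commutative ring and `S` a subgroup of `Rˣ` with `-1 ∈ S`.
If `Cay(R,S)` is connected and anti-connected and not prime, then there is a non-trivial
ideal `I` of `R` which is a homogeneous set of `Cay(R,S)`. -/
theorem not_prime_implies_homogeneous_ideal {R : Type*} [CommRing R] [Fintype R]
    (S : Set R)
    (hSunit : ∀ s ∈ S, IsUnit s)
    (hSone : (1 : R) ∈ S)
    (hSmul : ∀ a ∈ S, ∀ b ∈ S, a * b ∈ S)
    (hSinv : ∀ a ∈ S, ∀ b : R, a * b = 1 → b ∈ S)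
    (hSneg : (-1 : R) ∈ S)
    (Γ : SimpleGraph R) (hΓ : ∀ x y : R, Γ.Adj x y ↔ x - y ∈ S)
    (hconn : Γ.Connected) (hanti : Γᶜ.Connected)
    (hnotprime : ∃ H : Set R, Γ.IsHomogeneousSet H ∧
      2 ≤ H.ncard ∧ H.ncard < Fintype.card R) :
    ∃ I : Ideal R, I ≠ ⊥ ∧ I ≠ ⊤ ∧ Γ.IsHomogeneousSet (I : Set R) := by
  obtain ⟨H, hH, hcard, hcard'⟩ := hnotprime
  obtain ⟨a, ha, b, hb, hab⟩ := (Set.one_lt_ncard (Set.toFinite H)).1 hcard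
  have hHne : H ≠ Set.univ := by
    rintro rfl
    rw [Set.ncard_univ, Nat.card_eq_fintype_card] at hcard'
    exact hcard'.false
  have hzero : ({0} : Set R) ≠ Set.univ := by
    intro h
    have h0 (x : R) : x = 0 := by
      rw [← Set.mem_singleton_iff, h]
      trivial
    exact hab ((h0 a).trans (h0 b).symm)
  let translate (t : R) : Γ ≃g Γ :=
    { Equiv.addRight t with
      map_rel_iff' := fun {x y} => by simp [hΓ] }
  have hpre {K : Set R} (hK : K ≠ Set.univ) (f : Γ ≃g Γ) : f ⁻¹' K ≠ Set.univ := by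
    intro h
    apply hK
    rw [← Set.image_preimage_eq K f.surjective, h, Set.image_univ, f.surjective.range_eq]
  obtain ⟨M, ⟨hM, h0M, hMne⟩, hMmax⟩ :=
    Γ.exists_greatest_isHomogeneousSet hconn hanti hzero
  have hsub {x y : R} (hx : x ∈ M) (hy : y ∈ M) : x - y ∈ M := by
    refine hMmax ⟨hM.preimage (translate y), ?_, hpre hMne _⟩ ?_
    · change 0 + y ∈ M
      simpa using hy
    · change x - y + y ∈ M
      simpa using hx
  have hadd {x y : R} (hx : x ∈ M) (hy : y ∈ M) : x + y ∈ M := by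
    simpa using hsub hx (hsub h0M hy)
  have hSM {u x : R} (hu : u ∈ S) (hx : x ∈ M) : u * x ∈ M := by
    obtain ⟨v, huv⟩ := (hSunit u hu).exists_right_inv
    have hv : v ∈ S := hSinv u hu v huv
    have huv' (z : R) : u * (v * z) = z := by rw [← mul_assoc, huv, one_mul]
    have hvu' (z : R) : v * (u * z) = z := by rw [mul_left_comm, huv']
    let f : Γ ≃g Γ :=
      { toFun := fun z => v * z
        invFun := fun z => u * z
        left_inv := huv'
        right_inv := hvu'
        map_rel_iff' := fun {y z} => by
          simp only [Equiv.coe_fn_mk, hΓ, ← mul_sub]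
          refine ⟨fun h => ?_, hSmul v hv _⟩
          simpa only [huv'] using hSmul u hu _ h }
    refine hMmax ⟨hM.preimage f, ?_, hpre hMne _⟩ ?_
    · change v * 0 ∈ M
      simpa using h0M
    · change v * (u * x) ∈ M
      rwa [hvu']
  have hmul (r : R) {x : R} (hx : x ∈ M) : r * x ∈ M := by
    by_contra hr
    obtain ⟨s, hs, t, ht, hts⟩ := hconn.exists_adj_of_ne_univ (A := {s | s * x ∈ M})
      ⟨0, by simpa using h0M⟩ ((Set.ne_univ_iff_exists_notMem _).2 ⟨r, hr⟩)
    apply ht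
    simpa [sub_mul] using hadd (hSM ((hΓ t s).1 hts) hx) hs
  refine ⟨{ carrier := M, add_mem' := hadd, zero_mem' := h0M, smul_mem' := fun r _ => hmul r },
    fun h => ?_, fun h => hMne ?_, hM⟩
  · have hmem : b - a ∈ M := by
      refine hMmax ⟨hH.preimage (translate a), ?_, hpre hHne _⟩ ?_
      · change 0 + a ∈ H
        simpa using ha
      · change b - a + a ∈ H
        simpa using hb
    have hmem' : b - a ∈ (⊥ : Ideal R) := h ▸ hmem
    exact hab (sub_eq_zero.1 hmem').symm
  · exact congrArg (SetLike.coe : Ideal R → Set R) h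
end

section
/- Let R be a finite commutative ring, S a set of units of R with S = −S, and I an ideal of R. Then I is a homogeneous set of Cay(R,S) if and only if either I = R, or I ≠ R and S + I = S, where S + I = {s + m : s ∈ S, m ∈ I}. -/
open scoped Pointwise

/-- An ideal `I` of a finite commutative ring `R` is a homogeneous set of `Cay(R,S)` if
and only if either `I = R`, or `I ≠ R` and `S + I = S`. -/
theorem ideal_homogeneous_iff {R : Type*} [CommRing R] [Fintype R]
    (S : Set R)
    (hSunit : ∀ s ∈ S, IsUnit s)
    (hSneg : ∀ s ∈ S, -s ∈ S)
    (I : Ideal R)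
    (Γ : SimpleGraph R) (hΓ : ∀ x y : R, Γ.Adj x y ↔ x - y ∈ S) :
    Γ.IsHomogeneousSet (I : Set R) ↔
      (I = ⊤ ∨ (I ≠ ⊤ ∧ S + (I : Set R) = S)) := by
  constructor
  · intro h
    by_cases hI : I = ⊤
    · exact Or.inl hI
    refine Or.inr ⟨hI, Set.Subset.antisymm ?_ ?_⟩
    · rintro _ ⟨s, hs, m, hm, rfl⟩
      have hsI : s ∉ (I : Set R) := fun hmem =>
        hI (Ideal.eq_top_of_isUnit_mem I hmem (hSunit s hs))
      rcases h s hsI with hall | hnone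
      · simpa [hΓ] using hall (-m) (I.neg_mem hm)
      · exact absurd ((hΓ s 0).2 (by simpa using hs)) (hnone 0 I.zero_mem)
    · exact fun s hs => ⟨s, hs, 0, I.zero_mem, add_zero s⟩
  · rintro (rfl | ⟨-, hS⟩) v hv
    · exact absurd Submodule.mem_top hv
    · by_contra! hcon
      obtain ⟨⟨a, ha, hva⟩, b, hb, hvb⟩ := hcon
      refine hva ((hΓ v a).2 (hS ▸ ⟨v - b, (hΓ v b).1 hvb, b - a, I.sub_mem hb ha, ?_⟩))
      exact sub_add_sub_cancel v b a
end

section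
/- Let R be a finite commutative ring, S a set of units of R with S = −S and S ≠ ∅, and let I be an ideal of R with I ≠ R such that I is a homogeneous set of Cay(R,S). Then I is contained in the Jacobson radical of R. -/
/-- If `I ≠ R` is an ideal of a finite commutative ring `R` which is a homogeneous set of
`Cay(R,S)` (with `S` a nonempty symmetric set of units), then `I` is contained in the
Jacobson radical of `R`. -/
theorem homogeneous_ideal_le_jacobson {R : Type*} [CommRing R] [Fintype R]
    (S : Set R)
    (hSunit : ∀ s ∈ S, IsUnit s)
    (hSneg : ∀ s ∈ S, -s ∈ S)
    (hSne : S.Nonempty)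
    (I : Ideal R) (hIR : I ≠ ⊤)
    (Γ : SimpleGraph R) (hΓ : ∀ x y : R, Γ.Adj x y ↔ x - y ∈ S)
    (hhom : Γ.IsHomogeneousSet (I : Set R)) :
    I ≤ Ideal.jacobson (⊥ : Ideal R) := by
  obtain ⟨s, hs⟩ := hSne
  have hsI : s ∉ (I : Set R) := fun h => hIR (I.eq_top_of_isUnit_mem h (hSunit s hs))
  have hadj : ∀ a ∈ (I : Set R), Γ.Adj s a :=
    (hhom s hsI).resolve_right fun h => h 0 I.zero_mem ((hΓ s 0).2 (by simpa using hs))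
  intro a ha
  rw [Ideal.mem_jacobson_bot]
  intro y
  have hmem : -(s * y) * a ∈ (I : Set R) := I.mul_mem_left _ ha
  have hunit : IsUnit (s * (a * y + 1)) := by
    convert hSunit _ ((hΓ _ _).1 (hadj _ hmem)) using 1
    ring
  exact isUnit_of_mul_isUnit_right hunit
end

section
/- Let R and R' be finite commutative rings, S a subgroup of R^× with −1 ∈ S, S' a subgroup of (R')^× with −1 ∈ S', and Φ : R → R' a surjective ring homomorphism with S = Φ⁻¹(S'). Let I' ≠ R' be an ideal of R' that is a homogeneous set of Cay(R',S'). Then I = Φ⁻¹(I') is an ideal of R with I ≠ R that is a homogeneous set of Cay(R,S). -/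
/-- Pulling back a homogeneous proper ideal along a surjective homomorphism
`Φ : (R,S) → (R',S')` yields a homogeneous proper ideal. -/
theorem preimage_homogeneous_ideal {R R' : Type*} [CommRing R] [Fintype R]
    [CommRing R'] [Fintype R']
    (S : Set R) (S' : Set R')
    (hSunit : ∀ s ∈ S, IsUnit s)
    (hSone : (1 : R) ∈ S)
    (hSmul : ∀ a ∈ S, ∀ b ∈ S, a * b ∈ S)
    (hSinv : ∀ a ∈ S, ∀ b : R, a * b = 1 → b ∈ S)
    (hSneg : (-1 : R) ∈ S)
    (hS'unit : ∀ s ∈ S', IsUnit s)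
    (hS'one : (1 : R') ∈ S')
    (hS'mul : ∀ a ∈ S', ∀ b ∈ S', a * b ∈ S')
    (hS'inv : ∀ a ∈ S', ∀ b : R', a * b = 1 → b ∈ S')
    (hS'neg : (-1 : R') ∈ S')
    (Φ : R →+* R') (hsurj : Function.Surjective Φ) (hpre : S = Φ ⁻¹' S')
    (I' : Ideal R') (hI' : I' ≠ ⊤)
    (Γ' : SimpleGraph R') (hΓ' : ∀ x y : R', Γ'.Adj x y ↔ x - y ∈ S')
    (hhom' : Γ'.IsHomogeneousSet (I' : Set R'))
    (Γ : SimpleGraph R) (hΓ : ∀ x y : R, Γ.Adj x y ↔ x - y ∈ S) :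
    Ideal.comap Φ I' ≠ ⊤ ∧ Γ.IsHomogeneousSet ((Ideal.comap Φ I' : Ideal R) : Set R) := by
  refine ⟨Ideal.comap_ne_top Φ hI', fun v hv => ?_⟩
  have adj_iff (x y : R) : Γ.Adj x y ↔ Γ'.Adj (Φ x) (Φ y) := by
    rw [hΓ, hΓ', hpre, Set.mem_preimage, map_sub]
  exact (hhom' (Φ v) hv).imp (fun h x hx => (adj_iff v x).2 (h (Φ x) hx))
    (fun h x hx hvx => h (Φ x) hx ((adj_iff v x).1 hvx))
end

section
/- Let R be a finite commutative ring, S a set of units of R with S = −S, and I an ideal of R with I ≠ R such that I is a homogeneous set of Cay(R,S). Let Φ : R → R/I be the quotient map. Then Φ⁻¹(Φ(S)) = S. -/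
/-- If `I ≠ R` is an ideal of a finite commutative ring `R` which is a homogeneous set of
`Cay(R,S)`, and `Φ : R → R/I` is the quotient map, then `Φ⁻¹(Φ(S)) = S`. -/
theorem preimage_image_of_quotient {R : Type*} [CommRing R] [Fintype R]
    (S : Set R)
    (hSunit : ∀ s ∈ S, IsUnit s)
    (hSneg : ∀ s ∈ S, -s ∈ S)
    (I : Ideal R) (hIR : I ≠ ⊤)
    (Γ : SimpleGraph R) (hΓ : ∀ x y : R, Γ.Adj x y ↔ x - y ∈ S)
    (hhom : Γ.IsHomogeneousSet (I : Set R)) :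
    (Ideal.Quotient.mk I) ⁻¹' ((Ideal.Quotient.mk I) '' S) = S := by
  refine Set.Subset.antisymm ?_ (Set.subset_preimage_image _ S)
  rintro x ⟨s, hs, hsx⟩
  have hsI : s ∉ (I : Set R) := fun h => hIR (I.eq_top_of_isUnit_mem h (hSunit s hs))
  have hadj : Γ.Adj s 0 := (hΓ s 0).2 (by simpa using hs)
  rcases hhom s hsI with hall | hnone
  · simpa using (hΓ s (s - x)).1 (hall _ (Ideal.Quotient.eq.1 hsx))
  · exact absurd hadj (hnone 0 I.zero_mem)
end

section
/- Let R be a finite commutative ring and S a subgroup of R^× with −1 ∈ S, and suppose Cay(R,S) is connected and anti-connected. Then Cay(R,S) is prime if and only if the pair (R,S) is primitive, i.e., the only ideal I of R satisfying S + I = S is the zero ideal. -/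
open scoped Pointwise

namespace SimpleGraph

variable {V : Type*} {G : SimpleGraph V} {H K : Set V}

/-- In a connected graph, every nonempty proper vertex set has an edge leaving it. -/
theorem Connected.exists_adj_mem_notMem (hG : G.Connected) (hne : H.Nonempty)
    (hH : H ≠ Set.univ) : ∃ a ∈ H, ∃ b ∉ H, G.Adj a b := by
  obtain ⟨u, hu⟩ := hne
  obtain ⟨v, hv⟩ := (Set.ne_univ_iff_exists_notMem H).1 hH
  obtain ⟨p⟩ := hG.preconnected u v
  obtain ⟨d, -, h₁, h₂⟩ := p.exists_boundary_dart H hu hv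
  exact ⟨d.fst, h₁, d.snd, h₂, d.adj⟩

namespace IsHomogeneousSet

theorem adj_iff (hH : G.IsHomogeneousSet H) {v a b : V} (hv : v ∉ H) (ha : a ∈ H)
    (hb : b ∈ H) : G.Adj v a ↔ G.Adj v b := by
  rcases hH v hv with h | h
  · exact iff_of_true (h a ha) (h b hb)
  · exact iff_of_false (h a ha) (h b hb)

theorem of_adj_iff (h : ∀ v ∉ H, ∀ a ∈ H, ∀ b ∈ H, G.Adj v a → G.Adj v b) :
    G.IsHomogeneousSet H := by
  intro v hv
  by_cases hex : ∃ a ∈ H, G.Adj v a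
  · obtain ⟨a, ha, hva⟩ := hex
    exact Or.inl fun b hb => h v hv a ha b hb hva
  · exact Or.inr fun b hb hvb => hex ⟨b, hb, hvb⟩

theorem singleton (v : V) : G.IsHomogeneousSet {v} :=
  of_adj_iff fun _ _ a ha b hb h => by
    rw [Set.mem_singleton_iff] at ha hb
    rwa [hb, ← ha]

theorem preimage_s13 (hH : G.IsHomogeneousSet H) (f : V → V)
    (hf : ∀ x y, G.Adj (f x) (f y) ↔ G.Adj x y) : G.IsHomogeneousSet (f ⁻¹' H) :=
  of_adj_iff fun v hv a ha b hb h =>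
    (hf v b).1 ((hH.adj_iff hv ha hb).1 ((hf v a).2 h))

theorem union_s13 (hH : G.IsHomogeneousSet H) (hK : G.IsHomogeneousSet K)
    (hHK : (H ∩ K).Nonempty) : G.IsHomogeneousSet (H ∪ K) := by
  obtain ⟨c, hcH, hcK⟩ := hHK
  have key : ∀ v ∉ H ∪ K, ∀ a ∈ H ∪ K, G.Adj v a ↔ G.Adj v c := by
    intro v hv a ha
    rw [Set.mem_union, not_or] at hv
    exact ha.elim (fun ha => hH.adj_iff hv.1 ha hcH) fun ha => hK.adj_iff hv.2 ha hcK
  exact of_adj_iff fun v hv a ha b hb h => (key v hv b hb).2 ((key v hv a ha).1 h)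

/-- In a connected and anti-connected graph, two proper homogeneous sets do not
cover the vertex set. -/
theorem union_ne_univ_s13 (hG : G.Connected) (hGc : Gᶜ.Connected)
    (hH : G.IsHomogeneousSet H) (hK : G.IsHomogeneousSet K) (hH' : H ≠ Set.univ)
    (hK' : K ≠ Set.univ) : H ∪ K ≠ Set.univ := by
  intro hU
  have hmem : ∀ v ∉ H, v ∈ K := fun v hv => (hU.symm ▸ Set.mem_univ v : v ∈ H ∪ K).resolve_left hv
  obtain ⟨b, hbK⟩ := (Set.ne_univ_iff_exists_notMem K).1 hK'
  have hbH : b ∈ H := by_contra fun h => hbK (hmem b h)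
  have key : ∀ v ∉ H, ∀ w ∉ H, ∀ x ∈ H, ∀ y ∈ H, G.Adj x v → G.Adj y w := by
    intro v hv w hw x hx y hy h
    have hbv : G.Adj b v := ((hH.adj_iff hv hx hbH).1 h.symm).symm
    have hbw : G.Adj b w := (hK.adj_iff hbK (hmem v hv) (hmem w hw)).1 hbv
    exact ((hH.adj_iff hw hbH hy).1 hbw.symm).symm
  obtain ⟨x, hx, v, hv, hxv⟩ := hG.exists_adj_mem_notMem ⟨b, hbH⟩ hH'
  obtain ⟨y, hy, w, hw, hyw⟩ := hGc.exists_adj_mem_notMem ⟨b, hbH⟩ hH'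
  exact ((compl_adj _ _ _).1 hyw).2 (key v hv w hw x hx y hy hxv)

/-- In a finite connected and anti-connected graph with at least two vertices, every vertex lies
in a proper homogeneous set containing all proper homogeneous sets that meet it. -/
theorem exists_absorbing [Finite V] [Nontrivial V] (hG : G.Connected) (hGc : Gᶜ.Connected)
    (v : V) : ∃ M : Set V, v ∈ M ∧ G.IsHomogeneousSet M ∧ M ≠ Set.univ ∧
      ∀ K, G.IsHomogeneousSet K → K ≠ Set.univ → (M ∩ K).Nonempty → K ⊆ M := by
  obtain ⟨M, hM⟩ := (Set.toFinite
    {M : Set V | v ∈ M ∧ G.IsHomogeneousSet M ∧ M ≠ Set.univ}).exists_maximal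
    ⟨{v}, rfl, singleton v, Set.singleton_ne_univ v⟩
  obtain ⟨hv, hMh, hMu⟩ := hM.prop
  refine ⟨M, hv, hMh, hMu, fun K hK hK' hMK => ?_⟩
  exact Set.subset_union_right.trans <| hM.le_of_ge
    ⟨Or.inl hv, hMh.union_s13 hK hMK, union_ne_univ_s13 hG hGc hMh hK hMu hK'⟩
    Set.subset_union_left

end IsHomogeneousSet

end SimpleGraph

/-- A connected and anti-connected Cayley graph of a finite commutative ring with respect to a
group of units has a proper ideal that contains every proper homogeneous set meeting it, and whose
cosets preserve the connection set. -/
theorem exists_absorbing_ideal {R : Type*} [CommRing R] [Finite R] [Nontrivial R] {S : Set R}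
    (hSunit : ∀ s ∈ S, IsUnit s)
    (hSmul : ∀ a ∈ S, ∀ b ∈ S, a * b ∈ S)
    (hSinv : ∀ a ∈ S, ∀ b : R, a * b = 1 → b ∈ S)
    {Γ : SimpleGraph R} (hΓ : ∀ x y : R, Γ.Adj x y ↔ x - y ∈ S)
    (hconn : Γ.Connected) (hanti : Γᶜ.Connected) :
    ∃ I : Ideal R, S + (I : Set R) = S ∧
      ∀ K, Γ.IsHomogeneousSet K → K ≠ Set.univ → ((I : Set R) ∩ K).Nonempty → K ⊆ I := by
  obtain ⟨M, h0, hM, hMu, habs⟩ :=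
    SimpleGraph.IsHomogeneousSet.exists_absorbing hconn hanti (0 : R)
  have hpre : ∀ f : R → R, Function.Surjective f → (∀ x y, Γ.Adj (f x) (f y) ↔ Γ.Adj x y) →
      ∀ z ∈ M, f z ∈ M → ∀ w, f w ∈ M → w ∈ M := fun f hs hf z hz hfz w hw =>
    habs _ (hM.preimage_s13 f hf) (fun h => hMu (hs.preimage_injective h)) ⟨z, hz, hfz⟩ hw
  have hshift : ∀ c : R, ∀ z ∈ M, z + c ∈ M → ∀ w, w + c ∈ M → w ∈ M := fun c =>
    hpre (· + c) (add_right_surjective c) fun x y => by simp [hΓ]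
  have hadd : ∀ x ∈ M, ∀ y ∈ M, x + y ∈ M := fun x hx y hy =>
    hshift (-x) x hx (by simpa using h0) _ (by simpa using hy)
  have hneg : ∀ x ∈ M, -x ∈ M := fun x hx =>
    hshift x 0 h0 (by simpa using hx) _ (by simpa using h0)
  have hsmul : ∀ s ∈ S, ∀ x ∈ M, s * x ∈ M := by
    intro s hs x hx
    obtain ⟨t, hst⟩ := (hSunit s hs).exists_right_inv
    have hts : t * s = 1 := by rw [mul_comm, hst]
    refine hpre (t * ·) (fun y => ⟨s * y, by simp [← mul_assoc, hts]⟩) (fun y z => ?_) 0 h0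
      (by simpa using h0) _ (by simpa [← mul_assoc, hts] using hx)
    rw [hΓ, hΓ, ← mul_sub]
    refine ⟨fun h => ?_, fun h => hSmul _ (hSinv s hs t hst) _ h⟩
    simpa [← mul_assoc, hst] using hSmul _ hs _ h
  let A : AddSubgroup R :=
    { carrier := {r | ∀ x ∈ M, r * x ∈ M}
      zero_mem' := fun x _ => by simpa using h0
      add_mem' := fun {a b} ha hb x hx => by
        simpa [add_mul] using hadd _ (ha x hx) _ (hb x hx)
      neg_mem' := fun {a} ha x hx => by simpa using hneg _ (ha x hx) }
  have hA : (A : Set R) = Set.univ := by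
    by_contra hA
    obtain ⟨a, ha, b, hb, hab⟩ := hconn.exists_adj_mem_notMem ⟨0, A.zero_mem⟩ hA
    have hab' : a - b ∈ A := hsmul _ ((hΓ a b).1 hab)
    exact hb (by simpa using A.sub_mem ha hab')
  let I : Ideal R :=
    { carrier := M
      zero_mem' := h0
      add_mem' := fun {a b} ha hb => hadd a ha b hb
      smul_mem' := fun r x hx => (hA.symm ▸ Set.mem_univ r : r ∈ (A : Set R)) x hx }
  refine ⟨I, (Set.Subset.antisymm ?_ fun s hs => ⟨s, hs, 0, h0, add_zero s⟩), habs⟩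
  rintro _ ⟨s, hs, m, hm, rfl⟩
  have hsM : s ∉ M := fun h => hMu <| by
    have hI : I = ⊤ := Ideal.eq_top_of_isUnit_mem I h (hSunit s hs)
    exact congrArg (fun J : Ideal R => (J : Set R)) hI
  have h := (hM.adj_iff hsM h0 (hneg m hm)).1 ((hΓ s 0).2 (by simpa using hs))
  simpa [hΓ] using h

/-- An ideal whose cosets preserve the connection set of a Cayley graph is homogeneous. -/
theorem Ideal.isHomogeneousSet_of_add_eq {R : Type*} [CommRing R] {S : Set R}
    {Γ : SimpleGraph R} (hΓ : ∀ x y : R, Γ.Adj x y ↔ x - y ∈ S) {I : Ideal R}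
    (hI : S + (I : Set R) = S) : Γ.IsHomogeneousSet (I : Set R) := by
  refine SimpleGraph.IsHomogeneousSet.of_adj_iff fun v _ a ha b hb h => ?_
  rw [hΓ] at h ⊢
  rw [← hI]
  exact ⟨v - a, h, a - b, I.sub_mem ha hb, by simp⟩

/-- Let `R` be a finite commutative ring and `S` a subgroup of `Rˣ` with `-1 ∈ S`, and
suppose `Cay(R,S)` is connected and anti-connected. Then `Cay(R,S)` is prime if and only
if the pair `(R,S)` is primitive: the only ideal `I` of `R` with `S + I = S` is zero. -/
theorem cayley_prime_iff_primitive {R : Type*} [CommRing R] [Fintype R]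
    (S : Set R)
    (hSunit : ∀ s ∈ S, IsUnit s)
    (hSone : (1 : R) ∈ S)
    (hSmul : ∀ a ∈ S, ∀ b ∈ S, a * b ∈ S)
    (hSinv : ∀ a ∈ S, ∀ b : R, a * b = 1 → b ∈ S)
    (hSneg : (-1 : R) ∈ S)
    (Γ : SimpleGraph R) (hΓ : ∀ x y : R, Γ.Adj x y ↔ x - y ∈ S)
    (hconn : Γ.Connected) (hanti : Γᶜ.Connected) :
    (∀ H : Set R, Γ.IsHomogeneousSet H →
        ¬ (2 ≤ H.ncard ∧ H.ncard < Fintype.card R)) ↔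
      ∀ I : Ideal R, S + (I : Set R) = S → I = ⊥ := by
  have h0S : (0 : R) ∉ S := fun h => Γ.irrefl ((hΓ 0 0).2 (by simpa using h))
  have : Nontrivial R := ⟨⟨0, 1, fun h => h0S (h ▸ hSone)⟩⟩
  constructor
  · intro hprime I hI
    by_contra hbot
    refine hprime I (I.isHomogeneousSet_of_add_eq hΓ hI) ⟨?_, ?_⟩
    · obtain ⟨x, hx, hx0⟩ := Submodule.exists_mem_ne_zero_of_ne_bot hbot
      exact (Set.one_lt_ncard (Set.toFinite _)).2 ⟨x, hx, 0, I.zero_mem, hx0⟩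
    · rw [← Nat.card_eq_fintype_card]
      refine Set.ncard_lt_card fun hu => h0S ?_
      rw [← hI, hu]
      exact ⟨1, hSone, -1, Set.mem_univ _, by simp⟩
  · rintro hprim H hH ⟨h2, hlt⟩
    have hHu : H ≠ Set.univ := by
      rintro rfl
      simp [Set.ncard_univ] at hlt
    obtain ⟨x, hx, y, hy, hxy⟩ := (Set.one_lt_ncard (Set.toFinite _)).1 h2
    obtain ⟨I, hI, habs⟩ := exists_absorbing_ideal hSunit hSmul hSinv hΓ hconn hanti
    have hyx : y - x ∈ (I : Set R) := by
      refine habs ((· + x) ⁻¹' H) (hH.preimage_s13 _ fun a b => by simp [hΓ])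
        (fun h => hHu ((add_right_surjective x).preimage_injective h))
        ⟨0, I.zero_mem, by simpa using hx⟩ (by simpa using hy)
    rw [hprim I hI] at hyx
    exact hxy (sub_eq_zero.1 (by simpa using hyx)).symm
end

section
/- Let R be a finite commutative ring and ψ : R → ℂ an even multiplicative function. If ψ is not primitive, i.e., there is an ideal I of R with 0 ≠ I ≠ R such that ψ(x+m) = ψ(x) for all x ∈ R and m ∈ I, then the generalized Paley graph P_ψ is not prime; indeed, such an ideal I is a non-trivial homogeneous set of P_ψ. -/
/-- If an even multiplicative function `ψ : R → ℂ` is not primitive, witnessed by a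
non-trivial ideal `I` through which `ψ` factors, then `I` is a non-trivial homogeneous
set of the generalized Paley graph `P_ψ`; in particular `P_ψ` is not prime. -/
theorem not_primitive_implies_not_prime {R : Type*} [CommRing R] [Fintype R]
    (ψ : R → ℂ)
    (hmul : ∀ a b : R, ψ (a * b) = ψ a * ψ b)
    (hzero : ψ 0 = 0) (hone : ψ 1 = 1) (heven : ψ (-1) = 1)
    (I : Ideal R) (hI0 : I ≠ ⊥) (hIR : I ≠ ⊤)
    (hfactor : ∀ x : R, ∀ m ∈ I, ψ (x + m) = ψ x)
    (Γ : SimpleGraph R) (hΓ : ∀ x y : R, Γ.Adj x y ↔ x ≠ y ∧ ψ (x - y) = 1) :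
    Γ.IsHomogeneousSet (I : Set R) ∧
      2 ≤ (I : Set R).ncard ∧ (I : Set R).ncard < Fintype.card R := by
  refine ⟨fun v hv => ?_, ?_, ?_⟩
  · have key : ∀ h ∈ (I : Set R), (Γ.Adj v h ↔ ψ v = 1) := by
      intro h hh
      have hne : v ≠ h := fun e => hv (e ▸ hh)
      rw [hΓ, sub_eq_add_neg, hfactor v (-h) (I.neg_mem hh)]
      exact and_iff_right hne
    by_cases h1 : ψ v = 1
    · exact Or.inl fun h hh => (key h hh).2 h1
    · exact Or.inr fun h hh hadj => h1 ((key h hh).1 hadj)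
  · obtain ⟨m, hm, hm0⟩ := Submodule.exists_mem_ne_zero_of_ne_bot hI0
    exact (Set.one_lt_ncard (Set.toFinite _)).2 ⟨m, hm, 0, I.zero_mem, hm0⟩
  · rw [← Nat.card_eq_fintype_card]
    exact Set.ncard_lt_card fun h => hIR (SetLike.coe_injective (h.trans Submodule.top_coe.symm))
end

section
/- Let R be a finite commutative ring and ψ : R → ℂ a primitive multiplicative function. Then for every a ∈ R, a is a unit of R if and only if ψ(a) ≠ 0. In particular {a ∈ R : ψ(a) = 1} consists of units of R. -/
/-- If `ψ : R → ℂ` is a primitive multiplicative function on a finite commutative ring,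
then `a` is a unit iff `ψ a ≠ 0`; in particular `{a | ψ a = 1}` consists of units. -/
theorem primitive_implies_unit {R : Type*} [CommRing R] [Fintype R]
    (ψ : R → ℂ)
    (hmul : ∀ a b : R, ψ (a * b) = ψ a * ψ b)
    (hzero : ψ 0 = 0) (hone : ψ 1 = 1)
    (hprim : ∀ I : Ideal R, I ≠ ⊥ → ∃ x : R, ∃ m ∈ I, ψ (x + m) ≠ ψ x) :
    (∀ a : R, IsUnit a ↔ ψ a ≠ 0) ∧ (∀ a : R, ψ a = 1 → IsUnit a) := by
  have ne_zero_of_isUnit {a : R} (ha : IsUnit a) : ψ a ≠ 0 := by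
    obtain ⟨b, hb⟩ := ha.exists_right_inv
    intro h
    have hab := hmul a b
    rw [hb, h, hone, zero_mul] at hab
    exact one_ne_zero hab
  have isUnit_of_ne_zero {a : R} (ha : ψ a ≠ 0) : IsUnit a := by
    by_cases hker : LinearMap.ker (LinearMap.mulLeft R a) = ⊥
    · obtain ⟨b, hb⟩ := Finite.surjective_of_injective (LinearMap.ker_eq_bot.mp hker) 1
      exact IsUnit.of_mul_eq_one b hb
    · obtain ⟨x, m, hm, hne⟩ := hprim _ hker
      have ham : a * m = 0 := hm
      refine absurd (mul_left_cancel₀ ha ?_) hne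
      rw [← hmul, ← hmul, mul_add, ham, add_zero]
  exact ⟨fun a => ⟨ne_zero_of_isUnit, isUnit_of_ne_zero⟩,
    fun a ha => isUnit_of_ne_zero (ha ▸ one_ne_zero)⟩
end

section
/- Let R be a finite commutative ring and ψ : R → ℂ a primitive even multiplicative function. If the generalized Paley graph P_ψ is connected and is not a complete graph, then P_ψ is anti-connected. -/
/-- A primitive multiplicative function is supported on elements that are not zero divisors. -/
theorem eq_zero_of_mul_eq_zero_of_primitive {R : Type*} [CommRing R] {ψ : R → ℂ}
    (hmul : ∀ a b : R, ψ (a * b) = ψ a * ψ b)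
    (hprim : ∀ I : Ideal R, I ≠ ⊥ → ∃ x : R, ∃ m ∈ I, ψ (x + m) ≠ ψ x)
    {x m : R} (hx : ψ x ≠ 0) (hxm : x * m = 0) : m = 0 := by
  by_contra hm
  obtain ⟨a, b, hb, hne⟩ := hprim (Ideal.span {m}) (by simpa using hm)
  obtain ⟨r, rfl⟩ := Ideal.mem_span_singleton'.1 hb
  refine hne (mul_left_cancel₀ hx ?_)
  rw [← hmul, ← hmul]
  congr 1
  linear_combination r * hxm

/-- A primitive multiplicative function on a finite ring is supported on units. -/
theorem isUnit_of_primitive {R : Type*} [CommRing R] [Finite R] {ψ : R → ℂ}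
    (hmul : ∀ a b : R, ψ (a * b) = ψ a * ψ b)
    (hprim : ∀ I : Ideal R, I ≠ ⊥ → ∃ x : R, ∃ m ∈ I, ψ (x + m) ≠ ψ x)
    {x : R} (hx : ψ x ≠ 0) : IsUnit x := by
  have hinj : Function.Injective (x * ·) := fun a b hab =>
    sub_eq_zero.1 (eq_zero_of_mul_eq_zero_of_primitive hmul hprim hx
      (by simpa [mul_sub, sub_eq_zero] using hab))
  obtain ⟨y, hy⟩ := Finite.surjective_of_injective hinj 1
  exact IsUnit.of_mul_eq_one y hy

/-- If `ψ : R → ℂ` is a primitive even multiplicative function on a finite commutative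
ring such that the generalized Paley graph `P_ψ` is connected and not complete, then
`P_ψ` is anti-connected (its complement is connected). -/
theorem paley_anti_connected {R : Type*} [CommRing R] [Fintype R]
    (ψ : R → ℂ)
    (hmul : ∀ a b : R, ψ (a * b) = ψ a * ψ b)
    (hzero : ψ 0 = 0) (hone : ψ 1 = 1) (heven : ψ (-1) = 1)
    (hprim : ∀ I : Ideal R, I ≠ ⊥ → ∃ x : R, ∃ m ∈ I, ψ (x + m) ≠ ψ x)
    (Γ : SimpleGraph R) (hΓ : ∀ x y : R, Γ.Adj x y ↔ x ≠ y ∧ ψ (x - y) = 1)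
    (hconn : Γ.Connected)
    (hnotcomplete : ∃ x y : R, x ≠ y ∧ ¬ Γ.Adj x y) :
    Γᶜ.Connected := by
  have hadj : ∀ x y : R, Γᶜ.Adj x y ↔ x ≠ y ∧ ψ (x - y) ≠ 1 := fun x y => by
    rw [SimpleGraph.compl_adj, hΓ]; tauto
  have htrans : ∀ z x y : R, Γᶜ.Reachable x y → Γᶜ.Reachable (x + z) (y + z) := fun z x y h =>
    h.map ⟨(· + z), fun {a b} hab => by
      rw [hadj] at hab ⊢
      simpa using hab⟩
  have hscale : ∀ h x : R, ψ h = 1 → Γᶜ.Reachable 0 x → Γᶜ.Reachable 0 (h * x) := by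
    intro h x hh hx
    have := hx.map (⟨(h * ·), fun {a b} hab => by
      rw [hadj] at hab ⊢
      refine ⟨fun hab' => hab.1 (sub_eq_zero.1 (eq_zero_of_mul_eq_zero_of_primitive hmul hprim
        (x := h) (by simp [hh]) (by simpa [mul_sub, sub_eq_zero] using hab'))), ?_⟩
      rw [← mul_sub, hmul, hh, one_mul]
      exact hab.2⟩ : Γᶜ →g Γᶜ)
    simpa using this
  have hadd : ∀ x y : R, Γᶜ.Reachable 0 x → Γᶜ.Reachable 0 y → Γᶜ.Reachable 0 (x + y) :=
    fun x y hx hy => hy.trans (by simpa using htrans y 0 x hx)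
  have hsmul : ∀ r x : R, Γᶜ.Reachable 0 x → Γᶜ.Reachable 0 (r * x) := by
    intro r x hx
    have hr := (SimpleGraph.reachable_iff_reflTransGen _ _).1 (hconn.preconnected 0 r)
    induction hr with
    | refl => simp
    | @tail b c _ hbc ih =>
      have h1 := hadd _ _ (hscale (c - b) x ((hΓ _ _).1 hbc.symm).2 hx) ih
      rwa [← add_mul, sub_add_cancel] at h1
  let A : Ideal R :=
    { carrier := {x | Γᶜ.Reachable 0 x}
      add_mem' := fun {x y} hx hy => hadd x y hx hy
      zero_mem' := SimpleGraph.Reachable.refl 0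
      smul_mem' := fun r x hx => hsmul r x hx }
  have hmem : ∀ x : R, x ≠ 0 → ψ x ≠ 1 → x ∈ A := fun x hx hψ =>
    SimpleGraph.Adj.reachable (((hadj x 0).2 ⟨hx, by simpa using hψ⟩).symm)
  by_cases hA : A = ⊤
  · have hall : ∀ x : R, Γᶜ.Reachable 0 x := fun x => show x ∈ A by simp [hA]
    have : Nonempty R := ⟨0⟩
    exact ⟨fun x y => (hall x).symm.trans (hall y)⟩
  · exfalso
    have hin : ∀ x ∈ A, ψ x = 0 := fun x hx => by
      by_contra h
      exact hA (Ideal.eq_top_of_isUnit_mem A hx (isUnit_of_primitive hmul hprim h))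
    have hout : ∀ x ∉ A, ψ x = 1 := fun x hx => by
      by_contra h
      exact hx (hmem x (fun h0 => hx (h0 ▸ A.zero_mem)) h)
    obtain ⟨x, y, hxy, hnadj⟩ := hnotcomplete
    have hbot : A ≠ ⊥ := fun h => sub_ne_zero.2 hxy <| by
      have := hmem (x - y) (sub_ne_zero.2 hxy) fun h1 => hnadj ((hΓ x y).2 ⟨hxy, h1⟩)
      simpa [h] using this
    obtain ⟨a, m, hm, hne⟩ := hprim A hbot
    by_cases ha : a ∈ A
    · exact hne ((hin _ (A.add_mem ha hm)).trans (hin a ha).symm)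
    · exact hne ((hout _ fun h => ha ((A.add_mem_iff_left hm).1 h)).trans (hout a ha).symm)
end

section
/- Let R be a finite commutative ring and let X_R be its unitary Cayley graph, i.e., the simple graph with vertex set R in which x and y are adjacent iff x − y is a unit of R. Then X_R is prime if and only if either R has exactly two elements, or all of the following hold: the Jacobson radical of R is zero, R is not a field, and R has at most one maximal ideal m whose residue field R/m has exactly two elements. -/
section

variable {R : Type*} [CommRing R]

theorem isUnit_iff_forall_isMaximal_notMem {x : R} :
    IsUnit x ↔ ∀ m : Ideal R, m.IsMaximal → x ∉ m := by
  refine ⟨fun hx m hm hxm => hm.ne_top (Ideal.eq_top_of_isUnit_mem m hxm hx), fun h => ?_⟩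
  by_contra hx
  obtain ⟨m, hm, hxm⟩ := exists_max_ideal_of_mem_nonunits hx
  exact h m hm hxm

theorem Ideal.exists_notMem_sub_notMem_of_isMaximal {m : Ideal R} (hm : m.IsMaximal) {x : R}
    (h : Nat.card (R ⧸ m) = 2 → x ∈ m) : ∃ v : R, v ∉ m ∧ x - v ∉ m := by
  by_contra! hv
  have h1 : (1 : R) ∉ m := (Ideal.ne_top_iff_one m).mp hm.ne_top
  have hx : x ∉ m := fun hx => h1 (by simpa using m.sub_mem hx (hv 1 h1))
  refine hx (h ((Nat.card_eq_two_iff' (0 : R ⧸ m)).mpr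
    ⟨Ideal.Quotient.mk m x, fun h0 => hx (Ideal.Quotient.eq_zero_iff_mem.mp h0), ?_⟩))
  rintro y hy
  obtain ⟨y, rfl⟩ := Ideal.Quotient.mk_surjective y
  refine (Ideal.Quotient.mk_eq_mk_iff_sub_mem _ _).mpr ?_
  rw [← neg_sub]
  exact m.neg_mem (hv y fun h0 => hy (Ideal.Quotient.eq_zero_iff_mem.mpr h0))

theorem Ideal.sub_mem_of_card_quotient_eq_two {m : Ideal R} (h : Nat.card (R ⧸ m) = 2) {x y : R}
    (hx : x ∉ m) (hy : y ∉ m) : x - y ∈ m := by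
  obtain ⟨z, -, hz⟩ := (Nat.card_eq_two_iff' (0 : R ⧸ m)).mp h
  refine (Ideal.Quotient.mk_eq_mk_iff_sub_mem x y).mp ?_
  rw [hz (Ideal.Quotient.mk m x) fun h0 => hx (Ideal.Quotient.eq_zero_iff_mem.mp h0),
    hz (Ideal.Quotient.mk m y) fun h0 => hy (Ideal.Quotient.eq_zero_iff_mem.mp h0)]

theorem Ideal.exists_forall_isMaximal_sub_mem [Finite R] (f : Ideal R → R) :
    ∃ r : R, ∀ m : Ideal R, m.IsMaximal → r - f m ∈ m := by
  obtain ⟨r, hr⟩ := Ideal.exists_forall_sub_mem_ideal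
    (I := fun m : MaximalSpectrum R => m.asIdeal)
    (fun m n hmn => Ideal.isCoprime_of_isMaximal fun h => hmn (MaximalSpectrum.ext h))
    (fun m => f m.asIdeal)
  exact ⟨r, fun m hm => hr ⟨m, hm⟩⟩

/-- In a finite commutative ring, an element lying in every maximal ideal of index two is a sum of
two units. -/
theorem exists_isUnit_isUnit_sub [Finite R] {x : R}
    (h : ∀ m : Ideal R, m.IsMaximal → Nat.card (R ⧸ m) = 2 → x ∈ m) :
    ∃ u : R, IsUnit u ∧ IsUnit (x - u) := by
  choose! f hf using fun (m : Ideal R) (hm : m.IsMaximal) =>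
    Ideal.exists_notMem_sub_notMem_of_isMaximal hm (h m hm)
  obtain ⟨u, hu⟩ := Ideal.exists_forall_isMaximal_sub_mem f
  refine ⟨u, isUnit_iff_forall_isMaximal_notMem.mpr fun m hm hum => (hf m hm).1 ?_,
    isUnit_iff_forall_isMaximal_notMem.mpr fun m hm hum => (hf m hm).2 ?_⟩
  · simpa using m.sub_mem hum (hu m hm)
  · simpa using m.add_mem hum (hu m hm)

/-- If at most one maximal ideal of a finite commutative ring has index two, then a nonempty set
stable under addition of units is the whole ring. -/
theorem eq_univ_of_add_isUnit_mem [Finite R]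
    (h2 : {m : Ideal R | m.IsMaximal ∧ Nat.card (R ⧸ m) = 2}.Subsingleton) {H : Set R}
    (hne : H.Nonempty) (hH : ∀ a ∈ H, ∀ u, IsUnit u → a + u ∈ H) : H = Set.univ := by
  have key : ∀ a ∈ H, ∀ x,
      (∀ m : Ideal R, m.IsMaximal → Nat.card (R ⧸ m) = 2 → x ∈ m) → a + x ∈ H := by
    intro a ha x hx
    obtain ⟨u, hu, hxu⟩ := exists_isUnit_isUnit_sub hx
    simpa [add_assoc] using hH _ (hH a ha u hu) _ hxu
  obtain ⟨a, ha⟩ := hne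
  refine Set.eq_univ_of_forall fun y => ?_
  by_cases hy : ∀ m : Ideal R, m.IsMaximal → Nat.card (R ⧸ m) = 2 → y - a ∈ m
  · simpa using key a ha _ hy
  · push Not at hy
    obtain ⟨m, hm, hm2, hym⟩ := hy
    have := key _ (hH a ha 1 isUnit_one) (y - a - 1) fun n hn hn2 => by
      obtain rfl := h2 ⟨hn, hn2⟩ ⟨hm, hm2⟩
      exact Ideal.sub_mem_of_card_quotient_eq_two hm2 hym
        ((Ideal.ne_top_iff_one n).mp hm.ne_top)
    convert this using 1
    ring

namespace SimpleGraph

variable {Γ : SimpleGraph R}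

theorem isHomogeneousSet_jacobson (hΓ : ∀ x y : R, Γ.Adj x y ↔ IsUnit (x - y)) :
    Γ.IsHomogeneousSet ((⊥ : Ideal R).jacobson : Set R) := by
  intro v _
  have key : ∀ h ∈ (⊥ : Ideal R).jacobson, Γ.Adj v h ↔ IsUnit v := by
    intro h hh
    rw [hΓ, isUnit_iff_forall_isMaximal_notMem, isUnit_iff_forall_isMaximal_notMem]
    refine forall₂_congr fun m hm => not_congr (m.sub_mem_iff_left ?_)
    exact Submodule.mem_sInf.mp hh m ⟨bot_le, hm⟩
  by_cases hv : IsUnit v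
  · exact .inl fun h hh => (key h hh).mpr hv
  · exact .inr fun h hh => mt (key h hh).mp hv

theorem isHomogeneousSet_of_isField (hΓ : ∀ x y : R, Γ.Adj x y ↔ IsUnit (x - y))
    (hR : IsField R) (H : Set R) : Γ.IsHomogeneousSet H := by
  let := hR.toField
  refine fun v hv => .inl fun h hh => (hΓ v h).mpr (isUnit_iff_ne_zero.mpr ?_)
  exact sub_ne_zero.mpr fun hvh => hv (hvh ▸ hh)

theorem isHomogeneousSet_mem_iff_mem (hΓ : ∀ x y : R, Γ.Adj x y ↔ IsUnit (x - y))
    {m n : Ideal R} (hm : m.IsMaximal) (hm2 : Nat.card (R ⧸ m) = 2)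
    (hn : n.IsMaximal) (hn2 : Nat.card (R ⧸ n) = 2) :
    Γ.IsHomogeneousSet {x | x ∈ m ↔ x ∈ n} := by
  refine fun v hv => .inr fun h hh hadj => hv ?_
  have hu := isUnit_iff_forall_isMaximal_notMem.mp ((hΓ v h).mp hadj)
  have key : ∀ p : Ideal R, p.IsMaximal → Nat.card (R ⧸ p) = 2 → (v ∈ p ↔ h ∉ p) :=
    fun p hp hp2 => ⟨fun h1 h2 => hu p hp (p.sub_mem h1 h2), fun h2 => by
      by_contra h1
      exact hu p hp (Ideal.sub_mem_of_card_quotient_eq_two hp2 h1 h2)⟩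
  exact (key m hm hm2).trans ((not_congr hh).trans (key n hn hn2).symm)

/-- A homogeneous set of a unitary Cayley graph contains every neighbour of each of its elements,
provided that the Jacobson radical vanishes and that the ring has more than one maximal ideal. -/
theorem IsHomogeneousSet.add_isUnit_mem [Finite R]
    (hΓ : ∀ x y : R, Γ.Adj x y ↔ IsUnit (x - y)) (hJ : (⊥ : Ideal R).jacobson = ⊥)
    (hex : ∀ m : Ideal R, m.IsMaximal → ∃ n : Ideal R, n.IsMaximal ∧ n ≠ m) {H : Set R}
    (hH : Γ.IsHomogeneousSet H) (hnt : H.Nontrivial) :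
    ∀ a ∈ H, ∀ u, IsUnit u → a + u ∈ H := by
  classical
  have step : ∀ a ∈ H, ∀ b ∈ H, ∀ m : Ideal R, m.IsMaximal → ∀ v, IsUnit (v - a) →
      v - b ∈ m → v ∈ H := by
    intro a ha b hb m hm v hva hvb
    by_contra hv
    rcases hH v hv with h | h
    · exact isUnit_iff_forall_isMaximal_notMem.mp ((hΓ v b).mp (h b hb)) m hm hvb
    · exact h a ha ((hΓ v a).mpr hva)
  intro a ha u hu
  obtain ⟨b, hb, hba⟩ := hnt.exists_ne a
  obtain ⟨m, hm, hbm⟩ : ∃ m : Ideal R, m.IsMaximal ∧ b - a ∉ m := by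
    by_contra! h
    refine hba (sub_eq_zero.mp ?_)
    rw [← Ideal.mem_bot, ← hJ]
    exact Submodule.mem_sInf.mpr fun m hm => h m hm.2
  obtain ⟨n, hn, hnm⟩ := hex m hm
  obtain ⟨v, hv⟩ := Ideal.exists_forall_isMaximal_sub_mem
    fun p : Ideal R => if p = m then b else a + u
  have hvm : v - b ∈ m := by simpa using hv m hm
  have hvp : ∀ p : Ideal R, p.IsMaximal → p ≠ m → v - (a + u) ∈ p := fun p hp hpm => by
    simpa [hpm] using hv p hp
  have hva : IsUnit (v - a) := by
    refine isUnit_iff_forall_isMaximal_notMem.mpr fun p hp hvap => ?_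
    by_cases hpm : p = m
    · subst hpm
      exact hbm (by simpa using p.sub_mem hvap hvm)
    · refine isUnit_iff_forall_isMaximal_notMem.mp hu p hp ?_
      convert p.sub_mem hvap (hvp p hp hpm) using 1
      ring
  refine step a ha v (step a ha b hb m hm v hva hvm) n hn (a + u) (by simpa using hu) ?_
  rw [← neg_sub]
  exact n.neg_mem (hvp n hn hnm)

end SimpleGraph

end

/-- The unitary Cayley graph `X_R` of a finite commutative ring `R` is prime if and only
if either `R` has exactly two elements, or all of the following hold: the Jacobson
radical of `R` is zero, `R` is not a field, and `R` has at most one maximal ideal whose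
residue field has exactly two elements. -/
theorem unitary_cayley_prime_iff {R : Type*} [CommRing R] [Fintype R]
    (Γ : SimpleGraph R) (hΓ : ∀ x y : R, Γ.Adj x y ↔ IsUnit (x - y)) :
    (∀ H : Set R, Γ.IsHomogeneousSet H →
        ¬ (2 ≤ H.ncard ∧ H.ncard < Fintype.card R)) ↔
      (Fintype.card R = 2 ∨
        (Ideal.jacobson (⊥ : Ideal R) = ⊥ ∧ ¬ IsField R ∧
          {m : Ideal R | m.IsMaximal ∧ Nat.card (R ⧸ m) = 2}.Subsingleton)) := by
  have hnt : Nontrivial R := by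
    by_contra h
    rw [not_nontrivial_iff_subsingleton] at h
    exact Γ.irrefl ((hΓ 0 0).mpr (isUnit_of_subsingleton _))
  have hlt : ∀ H : Set R, H.ncard < Fintype.card R ↔ H ≠ Set.univ := fun H => by
    rw [← Nat.card_eq_fintype_card, ← Set.ncard_univ]
    exact ⟨fun h he => h.ne (he ▸ rfl), fun h => Set.ncard_lt_ncard (Set.ssubset_univ_iff.mpr h)⟩
  have htwo : ∀ H : Set R, 2 ≤ H.ncard ↔ H.Nontrivial := fun H =>
    Set.one_lt_ncard_iff_nontrivial
  simp only [hlt, htwo, not_and, not_not]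
  constructor
  · intro hprime
    by_cases hcard : Fintype.card R = 2
    · exact .inl hcard
    refine .inr ⟨?_, fun hfield => ?_, ?_⟩
    · by_contra hJ
      have := hprime _ (SimpleGraph.isHomogeneousSet_jacobson hΓ)
        (Submodule.nontrivial_iff_ne_bot.mpr hJ |> Set.nontrivial_coe_sort.mp)
      have h1 : (1 : R) ∈ ((⊥ : Ideal R).jacobson : Set R) := this ▸ Set.mem_univ 1
      exact bot_ne_top (Ideal.jacobson_eq_top_iff.mp ((Ideal.eq_top_iff_one _).mpr h1))
    · have := hprime {0, 1} (SimpleGraph.isHomogeneousSet_of_isField hΓ hfield _)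
        (Set.nontrivial_pair zero_ne_one)
      rw [← Nat.card_eq_fintype_card, ← Set.ncard_univ, ← this] at hcard
      exact hcard (Set.ncard_pair zero_ne_one)
    · rintro m ⟨hm, hm2⟩ n ⟨hn, hn2⟩
      have h1 : ∀ p : Ideal R, p.IsMaximal → (1 : R) ∉ p := fun p hp =>
        (Ideal.ne_top_iff_one p).mp hp.ne_top
      have := hprime _ (SimpleGraph.isHomogeneousSet_mem_iff_mem hΓ hm hm2 hn hn2)
        ⟨0, by simp, 1, by simp [h1 m hm, h1 n hn], zero_ne_one⟩
      exact Ideal.ext fun x => Set.eq_univ_iff_forall.mp this x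
  · rintro (hcard | ⟨hJ, hfield, h2⟩) H hH hHnt
    · rw [← htwo, ← hcard] at hHnt
      by_contra hne
      exact absurd ((hlt H).mpr hne) (not_lt.mpr hHnt)
    · refine eq_univ_of_add_isUnit_mem h2 hHnt.nonempty
        (hH.add_isUnit_mem hΓ hJ (fun m hm => ?_) hHnt)
      by_contra! h
      refine hfield (Ring.isField_iff_maximal_bot.mpr ?_)
      have : m = ⊥ := by
        rw [eq_bot_iff, ← hJ]
        exact le_sInf fun n hn => (h n hn.2).ge
      exact this ▸ hm
end
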